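/- For the distributed gradient-tracking algorithm with each f_i β-smooth, the gradient-tracking error satisfies, for every k ≥ 1: ‖s(k) − 𝟙g(k)‖ ≤ σ ‖s(k−1) − 𝟙g(k−1)‖ + β ‖x(k) − x(k−1)‖. -/

import Mathlib

open scoped BigOperators RealInnerProductSpace
open Filter

noncomputable section

abbrev Vec (N : ℕ) := EuclideanSpace ℝ (Fin N)

/-- Frobenius norm of a stacked matrix in `ℝ^{n×N}`, viewed as `n` rows in `ℝ^N`. -/
def fro {n N : ℕ} (A : Fin n → Vec N) : ℝ := Real.sqrt (∑ i, ‖A i‖ ^ 2)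

/-- Spectral norm (largest singular value) of a square real matrix, as the operator norm
of the induced linear map between Euclidean spaces. -/
def specNorm {n : ℕ} (M : Matrix (Fin n) (Fin n) ℝ) : ℝ :=
  ‖LinearMap.toContinuousLinearMap (Matrix.toEuclideanLin M)‖

lemma fro_nonneg {n N : ℕ} (A : Fin n → Vec N) : 0 ≤ fro A := Real.sqrt_nonneg _

lemma fro_sq {n N : ℕ} (A : Fin n → Vec N) : fro A ^ 2 = ∑ i, ‖A i‖ ^ 2 :=
  Real.sq_sqrt (Finset.sum_nonneg fun _ _ => sq_nonneg _)

lemma fro_eq_norm_toLp {n N : ℕ} (A : Fin n → Vec N) : fro A = ‖WithLp.toLp 2 A‖ := by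
  rw [PiLp.norm_eq_of_L2, fro]

lemma fro_add_le {n N : ℕ} (A B : Fin n → Vec N) :
    fro (fun i => A i + B i) ≤ fro A + fro B := by
  simp only [fro_eq_norm_toLp]
  exact norm_add_le (WithLp.toLp 2 A) (WithLp.toLp 2 B)

lemma norm_toEuclideanLin_apply_le {n : ℕ} (M : Matrix (Fin n) (Fin n) ℝ)
    (v : Vec n) : ‖Matrix.toEuclideanLin M v‖ ≤ specNorm M * ‖v‖ :=
  (LinearMap.toContinuousLinearMap (Matrix.toEuclideanLin M)).le_opNorm v

/-- The spectral norm controls left multiplication in the Frobenius norm. -/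
lemma fro_mul_le {n N : ℕ} (M : Matrix (Fin n) (Fin n) ℝ) (A : Fin n → Vec N) :
    fro (fun i => ∑ j, M i j • A j) ≤ specNorm M * fro A := by
  have hM : 0 ≤ specNorm M := norm_nonneg _
  refine le_of_sq_le_sq ?_ (mul_nonneg hM (fro_nonneg A))
  rw [mul_pow, fro_sq, fro_sq]
  simp only [EuclideanSpace.real_norm_sq_eq]
  rw [Finset.sum_comm, Finset.sum_comm (f := fun i c => (A i c) ^ 2), Finset.mul_sum]
  refine Finset.sum_le_sum fun c _ => ?_
  have h := pow_le_pow_left₀ (norm_nonneg _)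
    (norm_toEuclideanLin_apply_le M (WithLp.toLp 2 fun j => A j c)) 2
  rw [mul_pow, EuclideanSpace.real_norm_sq_eq, EuclideanSpace.real_norm_sq_eq] at h
  simpa [Matrix.toLpLin_apply, Matrix.mulVec, dotProduct] using h

/-- Subtracting the row average does not increase the Frobenius norm. -/
lemma fro_sub_average_le {n N : ℕ} (hn : 0 < n) (D : Fin n → Vec N) :
    fro (fun i => D i - (n : ℝ)⁻¹ • ∑ j, D j) ≤ fro D := by
  have hn0 : (n : ℝ) ≠ 0 := by positivity
  set m := (n : ℝ)⁻¹ • ∑ j, D j with hm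
  have hsum : ∑ j, D j = (n : ℝ) • m := by rw [hm, smul_inv_smul₀ hn0]
  refine Real.sqrt_le_sqrt ?_
  simp only [norm_sub_sq_real]
  rw [Finset.sum_add_distrib, Finset.sum_sub_distrib, ← Finset.mul_sum, ← sum_inner, hsum,
    real_inner_smul_left, real_inner_self_eq_norm_sq]
  simp only [Finset.sum_const, Finset.card_univ, Fintype.card_fin, nsmul_eq_mul]
  nlinarith [mul_nonneg (Nat.cast_nonneg (α := ℝ) n) (sq_nonneg ‖m‖)]

/-- A rowwise bound carries over to Frobenius norms; the factor may have either sign. -/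
lemma fro_le_of_forall_norm_le {n N : ℕ} {β : ℝ} {D E : Fin n → Vec N}
    (h : ∀ i, ‖D i‖ ≤ β * ‖E i‖) : fro D ≤ β * fro E := by
  rcases le_or_gt 0 β with hβ | hβ
  · refine le_of_sq_le_sq ?_ (mul_nonneg hβ (fro_nonneg E))
    rw [mul_pow, fro_sq, fro_sq, Finset.mul_sum]
    refine Finset.sum_le_sum fun i _ => ?_
    rw [← mul_pow]
    exact pow_le_pow_left₀ (norm_nonneg _) (h i) 2
  · have hE : ∀ i, ‖E i‖ = 0 := fun i => by
      nlinarith [h i, norm_nonneg (D i), norm_nonneg (E i)]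
    have hD : ∀ i, ‖D i‖ = 0 := fun i =>
      le_antisymm (by simpa [hE i] using h i) (norm_nonneg _)
    simp [fro, hE, hD]

lemma sum_sum_smul_of_col_sum_eq_one {n N : ℕ} {W : Matrix (Fin n) (Fin n) ℝ}
    (hW : ∀ j, ∑ i, W i j = 1) (A : Fin n → Vec N) :
    ∑ i, ∑ j, W i j • A j = ∑ j, A j := by
  rw [Finset.sum_comm]
  simp [← Finset.sum_smul, hW]

/-- Deviations from the average are propagated by `W` minus the averaging matrix. -/
lemma sum_smul_sub_average {n N : ℕ} {W : Matrix (Fin n) (Fin n) ℝ}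
    (hW : ∀ i, ∑ j, W i j = 1) {A : Fin n → Vec N} {a : Vec N}
    (ha : ∑ j, A j = (n : ℝ) • a) (i : Fin n) :
    ∑ j, (W - (n : ℝ)⁻¹ • Matrix.of (fun _ _ => (1 : ℝ)) : Matrix (Fin n) (Fin n) ℝ) i j •
      (A j - a) =
      (∑ j, W i j • A j) - a := by
  have hdev : ∑ j, (A j - a) = 0 := by
    simp [Finset.sum_sub_distrib, ha, ← Nat.cast_smul_eq_nsmul ℝ]
  simp only [Matrix.sub_apply, Matrix.smul_apply, Matrix.of_apply, smul_eq_mul, mul_one, sub_smul,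
    Finset.sum_sub_distrib]
  rw [← Finset.smul_sum, hdev]
  simp [smul_sub, Finset.sum_sub_distrib, ← Finset.sum_smul, hW]

theorem statement5
    {n N : ℕ} (hn : 0 < n)
    (β : ℝ)
    (f : Fin n → Vec N → ℝ)
    (hdiff : ∀ i, Differentiable ℝ (f i))
    (hsmooth : ∀ i, ∀ u v : Vec N,
      ‖gradient (f i) u - gradient (f i) v‖ ≤ β * ‖u - v‖)
    (W : Matrix (Fin n) (Fin n) ℝ)
    (hWnonneg : ∀ i j, 0 ≤ W i j)
    (hWrow : ∀ i, ∑ j, W i j = 1)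
    (hWcol : ∀ j, ∑ i, W i j = 1)
    (σ : ℝ)
    (hσ : σ = specNorm (W - (n : ℝ)⁻¹ • Matrix.of (fun _ _ => (1 : ℝ))))
    (η : ℝ) (hη : 0 < η)
    (x s : ℕ → Fin n → Vec N)
    (hs0 : ∀ i, s 0 i = gradient (f i) (x 0 i))
    (hxupd : ∀ t i, x (t + 1) i = (∑ j, W i j • x t j) - η • s t i)
    (hsupd : ∀ t i, s (t + 1) i =
      (∑ j, W i j • s t j) + gradient (f i) (x (t + 1) i) - gradient (f i) (x t i))
    (g : ℕ → Vec N)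
    (hg : ∀ t, g t = (n : ℝ)⁻¹ • ∑ i, gradient (f i) (x t i)) :
    ∀ k : ℕ,
      fro (fun i => s (k + 1) i - g (k + 1)) ≤
        σ * fro (fun i => s k i - g k) + β * fro (fun i => x (k + 1) i - x k i) := by
  have hn0 : (n : ℝ) ≠ 0 := by positivity
  have hsum : ∀ t, ∑ i, s t i = ∑ i, gradient (f i) (x t i) := by
    intro t
    induction t with
    | zero => simp only [hs0]
    | succ t ih =>
      simp only [hsupd, Finset.sum_sub_distrib, Finset.sum_add_distrib]
      rw [sum_sum_smul_of_col_sum_eq_one hWcol, ih]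
      abel
  intro k
  set D : Fin n → Vec N := fun i => gradient (f i) (x (k + 1) i) - gradient (f i) (x k i) with hD
  have hmean : (n : ℝ)⁻¹ • ∑ j, D j = g (k + 1) - g k := by
    simp only [hD, hg, Finset.sum_sub_distrib, smul_sub]
  have hs : ∑ j, s k j = (n : ℝ) • g k := by
    rw [hsum, hg, smul_inv_smul₀ hn0]
  have hdecomp : (fun i => s (k + 1) i - g (k + 1)) = fun i =>
      (∑ j, (W - (n : ℝ)⁻¹ • Matrix.of (fun _ _ => (1 : ℝ)) : Matrix (Fin n) (Fin n) ℝ) i j •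
        (s k j - g k)) +
        (D i - (n : ℝ)⁻¹ • ∑ j, D j) := by
    funext i
    rw [sum_smul_sub_average hWrow hs, hmean, hsupd]
    simp only [hD]
    abel
  rw [hdecomp, hσ]
  refine (fro_add_le _ _).trans (add_le_add (fro_mul_le _ _) ?_)
  exact (fro_sub_average_le hn D).trans
    (fro_le_of_forall_norm_le fun i => hsmooth i (x (k + 1) i) (x k i))
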